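/- arXiv:1411.6911 — 4 statements merged into one kernel-verified Lean document; each statement's English description precedes it below -/
import Mathlib

section
/- Let (M, d) be a compact metric space and let G be a subgroup of Homeo(M), equipped with the compact-open topology, acting as a convergence group on M. Then G is closed in Homeo(M) and G is locally compact. -/
open Filter Topology Set

noncomputable section

/-- The group structure on self-homeomorphisms of a space. -/
instance homeoGroup (X : Type*) [TopologicalSpace X] : Group (X ≃ₜ X) where
  mul h₁ h₂ := h₂.trans h₁
  one := Homeomorph.refl X
  inv := Homeomorph.symm
  mul_assoc _ _ _ := rfl
  one_mul _ := Homeomorph.ext fun _ => rfl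
  mul_one _ := Homeomorph.ext fun _ => rfl
  inv_mul_cancel h := Homeomorph.ext fun x => h.symm_apply_apply x

/-- The compact-open topology on the group of self-homeomorphisms. -/
instance homeoTopSpace (X : Type*) [TopologicalSpace X] : TopologicalSpace (X ≃ₜ X) :=
  TopologicalSpace.induced (fun h => (⟨h, h.continuous⟩ : C(X, X))) ContinuousMap.compactOpen

/-- The triples of pairwise distinct points of `X`. -/
def distinctTriples (X : Type*) : Set (X × X × X) :=
  {t | t.1 ≠ t.2.1 ∧ t.1 ≠ t.2.2 ∧ t.2.1 ≠ t.2.2}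

/-- The diagonal action of a homeomorphism on triples. -/
def tripleMap {X : Type*} [TopologicalSpace X] (h : X ≃ₜ X) (t : X × X × X) : X × X × X :=
  (h t.1, h t.2.1, h t.2.2)

/-- A set `S` of self-homeomorphisms of `X` (with the subspace topology coming from the
compact-open topology) acts as a convergence group on `X`: the diagonal action on the space of
triples of pairwise distinct points is proper. -/
def ConvergenceActing {X : Type*} [TopologicalSpace X] (S : Set (X ≃ₜ X)) : Prop :=
  ∀ K : Set (X × X × X), K ⊆ distinctTriples X → IsCompact K →
    IsCompact {h : S | ∃ t ∈ K, tripleMap (h : X ≃ₜ X) t ∈ K}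

theorem isClosed_and_locallyCompactSpace_of_compact_between {X : Type*} [TopologicalSpace X]
    [T2Space X] {S : Set X} (h : ∀ x, ∃ U ∈ 𝓝 x, ∃ C, IsCompact C ∧ S ∩ U ⊆ C ∧ C ⊆ S) :
    IsClosed S ∧ LocallyCompactSpace S := by
  refine ⟨isClosed_of_closure_subset fun x hx => ?_, ?_⟩
  · obtain ⟨U, hU, C, hC, hSU, hCS⟩ := h x
    refine hCS (hC.isClosed.closure_subset_iff.2 hSU ?_)
    rw [mem_closure_iff_nhds] at hx ⊢
    intro V hV
    obtain ⟨y, ⟨hyV, hyU⟩, hyS⟩ := hx (V ∩ U) (inter_mem hV hU)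
    exact ⟨y, hyV, hyS, hyU⟩
  · have : WeaklyLocallyCompactSpace S := by
      refine ⟨fun x => ?_⟩
      obtain ⟨U, hU, C, hC, hSU, hCS⟩ := h x
      refine ⟨Subtype.val ⁻¹' C, ?_, ?_⟩
      · rw [Topology.IsEmbedding.subtypeVal.isCompact_iff, Subtype.image_preimage_coe,
          inter_eq_right.2 hCS]
        exact hC
      · exact mem_of_superset (continuous_subtype_val.continuousAt.preimage_mem_nhds hU)
          fun y hy => hSU ⟨y.2, hy⟩
    infer_instance

instance homeoT2Space (X : Type*) [TopologicalSpace X] [T2Space X] : T2Space (X ≃ₜ X) :=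
  T2Space.of_injective_continuous
    (f := fun h : X ≃ₜ X => (⟨h, h.continuous⟩ : C(X, X)))
    (fun _ _ h => Homeomorph.ext fun x => DFunLike.congr_fun h x) continuous_induced_dom

theorem continuous_homeo_eval {X : Type*} [TopologicalSpace X] (x : X) :
    Continuous fun h : X ≃ₜ X => h x :=
  (continuous_eval_const (F := C(X, X)) x).comp
    (continuous_induced_dom (f := fun h : X ≃ₜ X => (⟨h, h.continuous⟩ : C(X, X))))

theorem continuous_tripleMap_left {X : Type*} [TopologicalSpace X] (t : X × X × X) :
    Continuous fun h : X ≃ₜ X => tripleMap h t :=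
  (continuous_homeo_eval _).prodMk ((continuous_homeo_eval _).prodMk (continuous_homeo_eval _))

theorem isOpen_distinctTriples (X : Type*) [TopologicalSpace X] [T2Space X] :
    IsOpen (distinctTriples X) :=
  (isOpen_ne_fun continuous_fst continuous_snd.fst).inter
    ((isOpen_ne_fun continuous_fst continuous_snd.snd).inter
      (isOpen_ne_fun continuous_snd.fst continuous_snd.snd))

theorem tripleMap_mem_distinctTriples {X : Type*} [TopologicalSpace X] (h : X ≃ₜ X)
    {t : X × X × X} (ht : t ∈ distinctTriples X) : tripleMap h t ∈ distinctTriples X :=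
  ⟨h.injective.ne ht.1, h.injective.ne ht.2.1, h.injective.ne ht.2.2⟩

theorem finite_of_distinctTriples_eq_empty {X : Type*} (h : distinctTriples X = ∅) :
    Finite X := by
  by_contra hX
  have : Infinite X := not_finite_iff_infinite.1 hX
  let e := Infinite.natEmbedding X
  have : (e 0, e 1, e 2) ∈ distinctTriples X :=
    ⟨e.injective.ne (by decide), e.injective.ne (by decide), e.injective.ne (by decide)⟩
  exact notMem_empty _ (h ▸ this)

theorem ConvergenceActing.exists_compact_between {X : Type*} [TopologicalSpace X] [T2Space X]
    [LocallyCompactSpace X] {S : Set (X ≃ₜ X)} (hS : ConvergenceActing S) (f : X ≃ₜ X) :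
    ∃ U ∈ 𝓝 f, ∃ C, IsCompact C ∧ S ∩ U ⊆ C ∧ C ⊆ S := by
  rcases (distinctTriples X).eq_empty_or_nonempty with h | ⟨t, ht⟩
  · have := finite_of_distinctTriples_eq_empty h
    have : Finite (X ≃ₜ X) :=
      Finite.of_injective Homeomorph.toEquiv Homeomorph.toEquiv_injective
    exact ⟨univ, univ_mem, S, S.toFinite.isCompact, inter_subset_left, Subset.rfl⟩
  · obtain ⟨L, hL, hLs, hLc⟩ := local_compact_nhds
      ((isOpen_distinctTriples X).mem_nhds (tripleMap_mem_distinctTriples f ht))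
    have hK := hS (insert t L) (insert_subset ht hLs) (hLc.insert t)
    refine ⟨(fun h : X ≃ₜ X => tripleMap h t) ⁻¹' L,
      (continuous_tripleMap_left t).continuousAt.preimage_mem_nhds hL, _,
      hK.image continuous_subtype_val, ?_, Subtype.coe_image_subset _ _⟩
    rintro h ⟨hh, hU⟩
    exact ⟨⟨h, hh⟩, ⟨t, mem_insert _ _, mem_insert_of_mem _ hU⟩, rfl⟩

/-- Let `M` be a compact metric space and let `G` be a subgroup of
`Homeo(M)` (with the compact-open topology) acting as a convergence group on `M`. Then `G` is
closed in `Homeo(M)` and `G` is locally compact. -/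
theorem statement_15 {M : Type*} [MetricSpace M] [CompactSpace M]
    (G : Subgroup (M ≃ₜ M)) (hG : ConvergenceActing (G : Set (M ≃ₜ M))) :
    IsClosed (G : Set (M ≃ₜ M)) ∧ LocallyCompactSpace G := by
  exact isClosed_and_locallyCompactSpace_of_compact_between hG.exists_compact_between
end
end

section
/- Let T be a locally finite thick tree and let G be a subgroup of Aut(T) acting 2-transitively on the set of ends of T. Then G contains a hyperbolic element, i.e. there exist g ∈ G, a bi-infinite geodesic (w_i)_{i∈ℤ} in T, and an integer k ≠ 0 such that g(w_i) = w_{i+k} for all i ∈ ℤ. -/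
open Filter Topology Set

noncomputable section

/-- The group of abstract automorphisms of the graph `G`. -/
def GraphAut {V : Type*} (G : SimpleGraph V) : Subgroup (Equiv.Perm V) where
  carrier := {φ | ∀ x y, G.Adj (φ x) (φ y) ↔ G.Adj x y}
  one_mem' := by intro x y; simp
  mul_mem' := by
    intro a b ha hb x y
    exact (ha (b x) (b y)).trans (hb x y)
  inv_mem' := by
    intro a ha x y
    conv_rhs => rw [show x = a (a.symm x) from (a.apply_symm_apply x).symm,
      show y = a (a.symm y) from (a.apply_symm_apply y).symm]
    exact (ha (a.symm x) (a.symm y)).symm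

/-- A ray in the graph `T`: an injective sequence of vertices, consecutively adjacent. -/
def IsRay {V : Type*} (T : SimpleGraph V) (r : ℕ → V) : Prop :=
  Function.Injective r ∧ ∀ i, T.Adj (r i) (r (i + 1))

/-- Two rays are equivalent (define the same end) if their vertex sets have infinite
intersection. -/
def RayEquiv {V : Type*} (r s : ℕ → V) : Prop := (Set.range r ∩ Set.range s).Infinite

/-- A group `H` of permutations of the vertices of `T` acts 2-transitively on the set of ends
of `T`. -/
def TwoTransitiveOnEnds {V : Type*} (T : SimpleGraph V) (H : Subgroup (Equiv.Perm V)) : Prop :=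
  ∀ r₁ r₂ s₁ s₂ : ℕ → V, IsRay T r₁ → IsRay T r₂ → IsRay T s₁ → IsRay T s₂ →
    ¬ RayEquiv r₁ r₂ → ¬ RayEquiv s₁ s₂ →
    ∃ g ∈ H, RayEquiv (fun i => (g : Equiv.Perm V) (r₁ i)) s₁ ∧
      RayEquiv (fun i => (g : Equiv.Perm V) (r₂ i)) s₂

/-- A walk without backtracking: consecutive vertices are adjacent and no step is undone by the
next one. -/
def NonBacktracking {V : Type*} (T : SimpleGraph V) (p : ℕ → V) : Prop :=
  ∀ i, T.Adj (p i) (p (i + 1)) ∧ p i ≠ p (i + 2)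

/-- The graph automorphism `g` translates some bi-infinite geodesic of `T`. -/
def IsHyperbolic {V : Type*} (T : SimpleGraph V) (g : Equiv.Perm V) : Prop :=
  ∃ w : ℤ → V, Function.Injective w ∧ (∀ i, T.Adj (w i) (w (i + 1))) ∧
    ∃ k : ℤ, k ≠ 0 ∧ ∀ i, g (w i) = w (i + k)

section

variable {V : Type*} {T : SimpleGraph V}

theorem SimpleGraph.IsTree.eq_of_adj_of_dist (hT : T.IsTree) {v x y z : V} (hy : T.Adj y x)
    (hz : T.Adj z x) (hdy : T.dist v x = T.dist v y + 1) (hdz : T.dist v x = T.dist v z + 1) :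
    y = z := by
  obtain ⟨p, hp⟩ := hT.connected.exists_walk_length_eq_dist v y
  obtain ⟨q, hq⟩ := hT.connected.exists_walk_length_eq_dist v z
  have hp' : (p.concat hy).IsPath :=
    SimpleGraph.Walk.isPath_of_length_eq_dist _ (by simp [hp, hdy])
  have hq' : (q.concat hz).IsPath :=
    SimpleGraph.Walk.isPath_of_length_eq_dist _ (by simp [hq, hdz])
  have h := congrArg Subtype.val ((hT.isAcyclic.subsingleton_path v x).elim ⟨_, hp'⟩ ⟨_, hq'⟩)
  simpa using congrArg SimpleGraph.Walk.penultimate h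

namespace NonBacktracking

theorem shift {p : ℕ → V} (hp : NonBacktracking T p) (m : ℕ) :
    NonBacktracking T fun i => p (m + i) :=
  fun i => hp (m + i)

theorem dist_zero (hT : T.IsTree) {p : ℕ → V} (hp : NonBacktracking T p) (n : ℕ) :
    T.dist (p 0) (p n) = n ∧ T.dist (p 0) (p (n + 1)) = n + 1 := by
  induction n with
  | zero => exact ⟨by simp, by simpa using (hp 0).1⟩
  | succ n ih =>
    refine ⟨ih.2, ?_⟩
    have hadj := (hp (n + 1)).1
    rcases hT.dist_eq_dist_add_one_of_adj (p 0) hadj with h | h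
    · exact absurd (hT.eq_of_adj_of_dist (hp n).1 hadj.symm (by rw [ih.1, ih.2]) h) (hp n).2
    · rw [h, ih.2]

theorem injective (hT : T.IsTree) {p : ℕ → V} (hp : NonBacktracking T p) :
    Function.Injective p := by
  intro i j hij
  wlog h : i ≤ j generalizing i j
  · exact (this hij.symm (by omega)).symm
  have hd := ((hp.shift i).dist_zero hT (j - i)).1
  simp only [add_zero, Nat.add_sub_cancel' h, hij, SimpleGraph.dist_self] at hd
  omega

theorem isRay (hT : T.IsTree) {p : ℕ → V} (hp : NonBacktracking T p) : IsRay T p :=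
  ⟨hp.injective hT, fun i => (hp i).1⟩

theorem eq_of_le (hT : T.IsTree) {p q : ℕ → V} (hp : NonBacktracking T p)
    (hq : NonBacktracking T q) (h0 : p 0 = q 0) {m n : ℕ} (h : p m = q n) :
    ∀ i ≤ m, p i = q i := by
  have hmn : m = n := by
    rw [← (hp.dist_zero hT m).1, ← (hq.dist_zero hT n).1, h, h0]
  subst hmn
  intro i hi
  induction hi using Nat.decreasingInduction with
  | self => exact h
  | of_succ k _ ih =>
    refine hT.eq_of_adj_of_dist (v := p 0) (x := p (k + 1)) (hp k).1 (ih ▸ (hq k).1) ?_ ?_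
    · rw [(hp.dist_zero hT k).1, (hp.dist_zero hT k).2]
    · rw [(hp.dist_zero hT k).2, h0, (hq.dist_zero hT k).1]

theorem eq_of_rayEquiv (hT : T.IsTree) {p q : ℕ → V} (hp : NonBacktracking T p)
    (hq : NonBacktracking T q) (h : RayEquiv p q) {m n : ℕ} (hmn : p m = q n) (i : ℕ) :
    p (m + i) = q (n + i) := by
  obtain ⟨x, ⟨⟨a, rfl⟩, b, hb⟩, hx⟩ := h.exists_notMem_finite
    (((Set.finite_Iic (m + i)).image p).union ((Set.finite_Iic n).image q))
  have ha : m + i < a := by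
    by_contra hc
    exact hx (Or.inl ⟨a, by simpa using hc, rfl⟩)
  have hb' : n < b := by
    by_contra hc
    exact hx (Or.inr ⟨b, by simpa using hc, hb⟩)
  refine (hp.shift m).eq_of_le hT (hq.shift n) hmn (m := a - m) (n := b - n) ?_ i (by omega)
  rw [Nat.add_sub_cancel' (by omega), Nat.add_sub_cancel' (by omega), hb]

theorem map {g : Equiv.Perm V} (hg : g ∈ GraphAut T) {p : ℕ → V} (hp : NonBacktracking T p) :
    NonBacktracking T fun i => g (p i) :=
  fun i => ⟨(hg _ _).2 (hp i).1, fun h => (hp i).2 (g.injective h)⟩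

end NonBacktracking

theorem IsRay.nonBacktracking {p : ℕ → V} (hp : IsRay T p) : NonBacktracking T p :=
  fun i => ⟨hp.2 i, fun h => by have := hp.1 h; omega⟩

theorem Set.exists_mem_ne_ne_of_three_le_encard {α : Type*} {s : Set α} (hs : 3 ≤ s.encard)
    (a b : α) : ∃ c ∈ s, c ≠ a ∧ c ≠ b := by
  by_contra! h
  have hsub : s ⊆ {a, b} := fun c hc => by
    by_cases hca : c = a
    · exact Or.inl hca
    · exact Or.inr (h c hc hca)
  exact absurd (hs.trans ((Set.encard_le_encard hsub).trans
    ((Set.encard_insert_le {b} a).trans_eq (by rw [Set.encard_singleton])))) (by norm_num)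

theorem exists_nonBacktracking (hthick : ∀ v : V, 3 ≤ (T.neighborSet v).encard) {x y : V}
    (hxy : T.Adj x y) : ∃ p, NonBacktracking T p ∧ p 0 = x ∧ p 1 = y := by
  have hnext : ∀ e : {e : V × V // T.Adj e.1 e.2}, ∃ z, T.Adj e.1.2 z ∧ e.1.1 ≠ z := fun e => by
    obtain ⟨z, hz, hne, -⟩ := Set.exists_mem_ne_ne_of_three_le_encard (hthick e.1.2) e.1.1 e.1.1
    exact ⟨z, hz, hne.symm⟩
  choose next hadj hne using hnext
  let step : {e : V × V // T.Adj e.1 e.2} → {e : V × V // T.Adj e.1 e.2} :=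
    fun e => ⟨(e.1.2, next e), hadj e⟩
  let s : ℕ → {e : V × V // T.Adj e.1 e.2} := fun n => step^[n] ⟨(x, y), hxy⟩
  have hs : ∀ n, s (n + 1) = step (s n) := fun n => Function.iterate_succ_apply' _ _ _
  refine ⟨fun n => (s n).1.1, fun i => ?_, rfl, rfl⟩
  simp only [hs]
  exact ⟨(s i).2, hne _⟩

/-- The line that follows `p` backwards from `p (m + 1)` to `p 1 = q 0` and then follows `q` is
without backtracking. -/
theorem exists_nonBacktracking_join {p q : ℕ → V} (hp : NonBacktracking T p)
    (hq : NonBacktracking T q) (h0 : p 1 = q 0) (h1 : p 2 ≠ q 1) (m : ℕ) :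
    ∃ r, NonBacktracking T r ∧ r 0 = p (m + 1) ∧ ∀ i, r (m + i) = q i := by
  refine ⟨fun i => if i < m + 1 then p (m + 1 - i) else q (i - m), fun i => ?_, by simp,
    fun i => ?_⟩
  · rcases lt_or_ge i m with him | him
    · obtain ⟨d, rfl⟩ : ∃ d, m = i + 1 + d := ⟨m - (i + 1), by omega⟩
      have e0 : i + 1 + d + 1 - i = d + 2 := by omega
      have e1 : i + 1 + d + 1 - (i + 1) = d + 1 := by omega
      have l0 : i < i + 1 + d + 1 := by omega
      have l1 : i + 1 < i + 1 + d + 1 := by omega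
      simp only [e0, e1, l0, l1, if_true]
      refine ⟨(hp (d + 1)).1.symm, ?_⟩
      rcases d with _ | d
      · simpa [show i + 2 - (i + 1) = 1 by omega] using h1
      · have e2 : i + 1 + (d + 1) + 1 - (i + 2) = d + 1 := by omega
        have l2 : i + 2 < i + 1 + (d + 1) + 1 := by omega
        simp only [e2, l2, if_true]
        exact (hp (d + 1)).2.symm
    · obtain ⟨d, rfl⟩ := Nat.exists_eq_add_of_le him
      have e1 : m + d + 1 - m = d + 1 := by omega
      have e2 : m + d + 2 - m = d + 2 := by omega
      have l1 : ¬ m + d + 1 < m + 1 := by omega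
      have l2 : ¬ m + d + 2 < m + 1 := by omega
      simp only [e1, e2, l1, l2, if_false]
      rcases d with _ | d
      · simpa [h0] using hq 0
      · simpa using hq (d + 1)
  · rcases i with _ | i
    · simpa using h0
    · simp

theorem isHyperbolic_of_apply_eq (hT : T.IsTree) {f : Equiv.Perm V} (hf : f ∈ GraphAut T)
    {p : ℕ → V} {k : ℕ} (hk : 0 < k) (hp : ∀ i < k, T.Adj (p i) (p (i + 1)) ∧ p i ≠ p (i + 2))
    (h0 : f (p 0) = p k) (h1 : f (p 1) = p (k + 1)) : IsHyperbolic T f := by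
  let w : ℤ → V := fun i => (f ^ (i / k)) (p (i % k).toNat)
  have hkz : (0 : ℤ) < k := by exact_mod_cast hk
  have hwlt : ∀ (c : ℤ) (t : ℕ), t < k → w (c * k + t) = (f ^ c) (p t) := fun c t ht => by
    have e1 : (c * k + t : ℤ) / k = c := by
      rw [add_comm, Int.add_mul_ediv_right _ _ hkz.ne', Int.ediv_eq_zero_of_lt] <;> omega
    have e2 : (c * k + t : ℤ) % k = t := by
      rw [add_comm, Int.add_mul_emod_self_right, Int.emod_eq_of_lt] <;> omega
    simp only [w, e1, e2, Int.toNat_natCast]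
  have hwk : ∀ c : ℤ, w (c * k + k) = (f ^ c) (p k) := fun c => by
    have := hwlt (c + 1) 0 hk
    rw [zpow_add_one, Equiv.Perm.mul_apply, h0] at this
    rw [← this]; congr 1; push_cast; ring
  have hwle : ∀ (c : ℤ) (t : ℕ), t ≤ k → w (c * k + t) = (f ^ c) (p t) := fun c t ht => by
    rcases ht.lt_or_eq with h | rfl
    · exact hwlt c t h
    · exact hwk c
  have hw : ∀ (c : ℤ) (t : ℕ), t ≤ k + 1 → w (c * k + t) = (f ^ c) (p t) := fun c t ht => by
    rcases ht.lt_or_eq with h | rfl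
    · exact hwle c t (by omega)
    · have := hwle (c + 1) 1 hk
      rw [zpow_add_one, Equiv.Perm.mul_apply, h1] at this
      rw [← this]; congr 1; push_cast; ring
  have hnb : ∀ i, T.Adj (w i) (w (i + 1)) ∧ w i ≠ w (i + 2) := fun i => by
    obtain ⟨c, t, ht, rfl⟩ : ∃ (c : ℤ) (t : ℕ), t < k ∧ i = c * k + t := by
      have hnn := Int.emod_nonneg i hkz.ne'
      have hlt := Int.emod_lt_of_pos i hkz
      refine ⟨i / k, (i % k).toNat, by omega, ?_⟩
      rw [Int.toNat_of_nonneg hnn, Int.mul_comm, Int.mul_ediv_add_emod]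
    have e1 := hw c (t + 1) (by omega)
    have e2 := hw c (t + 2) (by omega)
    push_cast at e1 e2
    rw [add_assoc, add_assoc, e1, e2, hw c t (by omega)]
    exact ⟨((GraphAut T).zpow_mem hf c _ _).2 (hp t ht).1,
      fun h => (hp t ht).2 ((f ^ c).injective h)⟩
  refine ⟨w, ?_, fun i => (hnb i).1, k, hkz.ne', fun i => ?_⟩
  · intro i j hij
    wlog h : i ≤ j generalizing i j
    · exact (this hij.symm (by omega)).symm
    have hnat : NonBacktracking T fun n : ℕ => w (i + n) := fun n => by
      simpa [add_assoc] using hnb (i + n)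
    have := @NonBacktracking.injective V T hT _ hnat 0 (j - i).toNat
      (by rw [Int.toNat_of_nonneg (by omega)]; simpa using hij)
    omega
  · simp only [w]
    rw [Int.add_emod_right, Int.add_ediv_of_dvd_right (dvd_refl _), Int.ediv_self hkz.ne',
      add_comm _ (1 : ℤ), zpow_one_add, Equiv.Perm.mul_apply]

/-- In a group acting 2-transitively on the ends and without hyperbolic elements, each oriented
edge `(u, v)` admits an element fixing `u` and moving `v`. -/
theorem exists_isHyperbolic_or_fix_move (hT : T.IsTree)
    (hthick : ∀ v : V, 3 ≤ (T.neighborSet v).encard) {H : Subgroup (Equiv.Perm V)}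
    (hHaut : H ≤ GraphAut T) (h2t : TwoTransitiveOnEnds T H) {u v : V} (huv : T.Adj u v) :
    ∃ g ∈ H, IsHyperbolic T g ∨ (g u = u ∧ g v ≠ v) := by
  obtain ⟨α, hα, hα0, hα1⟩ := exists_nonBacktracking hthick huv.symm
  obtain ⟨β, hβ, hβ0, hβ1⟩ := exists_nonBacktracking hthick huv
  obtain ⟨v', hv', hvv', hv'α⟩ :=
    Set.exists_mem_ne_ne_of_three_le_encard (hthick u) v (α 2)
  obtain ⟨γ, hγ, hγ0, hγ1⟩ := exists_nonBacktracking hthick hv'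
  have hαβ1 : α 2 ≠ β 1 := by rw [hβ1, ← hα0]; exact (hα 0).2.symm
  have hαγ1 : α 2 ≠ γ 1 := by rw [hγ1]; exact hv'α.symm
  have hαβ : ¬ RayEquiv α β := fun h =>
    hαβ1 (hα.eq_of_rayEquiv hT hβ h (m := 1) (n := 0) (hα1.trans hβ0.symm) 1)
  have hαγ : ¬ RayEquiv α γ := fun h =>
    hαγ1 (hα.eq_of_rayEquiv hT hγ h (m := 1) (n := 0) (hα1.trans hγ0.symm) 1)
  obtain ⟨g, hgH, hgα, hgβ⟩ := h2t α β α γ (hα.isRay hT) (hβ.isRay hT) (hα.isRay hT)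
    (hγ.isRay hT) hαβ hαγ
  have hg := hHaut hgH
  obtain ⟨_, ⟨m, rfl⟩, n, hn⟩ := hgα.nonempty
  have htail : ∀ i, g (α (m + i)) = α (n + i) :=
    (hα.map hg).eq_of_rayEquiv hT hα hgα hn.symm
  rcases lt_trichotomy m n with hmn | rfl | hmn
  · refine ⟨g, hgH, Or.inl (isHyperbolic_of_apply_eq hT hg (p := fun i => α (m + i))
      (k := n - m) (by omega) (fun i _ => hα.shift m i) ?_ ?_)⟩
    · simpa [Nat.add_sub_cancel' hmn.le] using htail 0
    · simpa [← add_assoc, Nat.add_sub_cancel' hmn.le] using htail 1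
  · refine ⟨g, hgH, Or.inr ?_⟩
    obtain ⟨p, hp, hp0, hpβ⟩ :=
      exists_nonBacktracking_join hα hβ (hα1.trans hβ0.symm) hαβ1 m
    obtain ⟨q, hq, hq0, hqγ⟩ :=
      exists_nonBacktracking_join hα hγ (hα1.trans hγ0.symm) hαγ1 m
    have hpq : RayEquiv (fun i => g (p i)) q := by
      refine hgβ.mono (Set.inter_subset_inter ?_ ?_)
      · rintro _ ⟨i, rfl⟩
        exact ⟨m + i, by simp only [hpβ]⟩
      · rintro _ ⟨i, rfl⟩
        exact ⟨m + i, hqγ i⟩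
    have heq : ∀ i, g (β i) = γ i := fun i => by
      have := (hp.map hg).eq_of_rayEquiv hT hq hpq (m := 0) (n := 0)
        (by rw [hp0, hq0]; exact htail 1) (m + i)
      simpa only [zero_add, hpβ, hqγ] using this
    refine ⟨?_, ?_⟩
    · simpa only [hβ0, hγ0] using heq 0
    · have := heq 1
      rw [hβ1, hγ1] at this
      rw [this]
      exact hvv'
  · refine ⟨g⁻¹, H.inv_mem hgH, Or.inl (isHyperbolic_of_apply_eq hT (inv_mem hg)
      (p := fun i => α (n + i)) (k := m - n) (by omega) (fun i _ => hα.shift n i) ?_ ?_)⟩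
    · rw [Equiv.Perm.inv_eq_iff_eq]
      simpa [Nat.add_sub_cancel' hmn.le] using (htail 0).symm
    · rw [Equiv.Perm.inv_eq_iff_eq]
      simpa [← add_assoc, Nat.add_sub_cancel' hmn.le] using (htail 1).symm

/-- If `g` fixes `u` and moves `v` while `h` fixes `v` and moves `u`, for an edge `uv`, then
`g * h` is hyperbolic. -/
theorem isHyperbolic_mul_of_fix_move (hT : T.IsTree) {g h : Equiv.Perm V} (hg : g ∈ GraphAut T)
    (hh : h ∈ GraphAut T) {u v : V} (huv : T.Adj u v) (hgu : g u = u) (hgv : g v ≠ v)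
    (hhv : h v = v) (hhu : h u ≠ u) : IsHyperbolic T (g * h) := by
  have hhv' : h⁻¹ v = v := by rw [Equiv.Perm.inv_eq_iff_eq, hhv]
  have hhu' : h⁻¹ u ≠ u := by rw [Ne, Equiv.Perm.inv_eq_iff_eq]; exact hhu.symm
  let p : ℕ → V := fun i => match i with
    | 0 => h⁻¹ u
    | 1 => v
    | 2 => u
    | _ => g v
  refine isHyperbolic_of_apply_eq hT (mul_mem hg hh) (p := p) (k := 2) two_pos ?_ ?_ ?_
  · intro i hi
    interval_cases i
    · refine ⟨?_, hhu'⟩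
      have := (inv_mem hh : h⁻¹ ∈ GraphAut T) u v
      rw [hhv'] at this
      exact this.2 huv
    · exact ⟨huv.symm, hgv.symm⟩
  · simp [p, hgu]
  · simp [p, hhv]

end

/-- A group of automorphisms of a locally finite thick tree acting
2-transitively on the set of ends contains a hyperbolic element. -/
theorem statement_16 {V : Type*} (T : SimpleGraph V) (hT : T.IsTree)
    (hlf : ∀ v : V, (T.neighborSet v).Finite) (hthick : ∀ v : V, 3 ≤ (T.neighborSet v).encard)
    (H : Subgroup (Equiv.Perm V)) (hHaut : H ≤ GraphAut T)
    (h2t : TwoTransitiveOnEnds T H) :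
    ∃ g ∈ H, ∃ w : ℤ → V, Function.Injective w ∧ (∀ i, T.Adj (w i) (w (i + 1))) ∧
      ∃ k : ℤ, k ≠ 0 ∧ ∀ i, (g : Equiv.Perm V) (w i) = w (i + k) := by
  obtain ⟨u⟩ := hT.connected.nonempty
  obtain ⟨v, huv, -⟩ := Set.exists_mem_ne_ne_of_three_le_encard (hthick u) u u
  obtain ⟨g, hg, hgh | ⟨hgu, hgv⟩⟩ := exists_isHyperbolic_or_fix_move hT hthick hHaut h2t huv
  · exact ⟨g, hg, hgh⟩
  obtain ⟨h, hh, hhh | ⟨hhv, hhu⟩⟩ :=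
    exists_isHyperbolic_or_fix_move hT hthick hHaut h2t (SimpleGraph.Adj.symm huv)
  · exact ⟨h, hh, hhh⟩
  exact ⟨g * h, H.mul_mem hg hh,
    isHyperbolic_mul_of_fix_move hT (hHaut hg) (hHaut hh) huv hgu hgv hhv hhu⟩
end
end

section
/- Let T be a locally finite thick tree and let G be a subgroup of Aut(T) acting 2-transitively on the set of ends of T. Let r = (v_i)_{i≥1} be a ray in T and let v_0 and v_0' be two vertices of T adjacent to v_1 and different from v_2. Then there exists g ∈ G such that g(v_i) = v_i for all i ≥ 1 and g(v_0) = v_0'. -/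
open Filter Topology Set

noncomputable section

/-- A bi-infinite geodesic line, indexed by the integers. -/
def IsLine {V : Type*} (T : SimpleGraph V) (A : ℤ → V) : Prop :=
  Function.Injective A ∧ ∀ i, T.Adj (A i) (A (i + 1))

section Lines

variable {V : Type*} {T : SimpleGraph V}

lemma exists_walk_of_adj_succ {f : ℕ → V} (hf : ∀ i, T.Adj (f i) (f (i + 1))) (n : ℕ) {u v : V}
    (hu : f 0 = u) (hv : f n = v) :
    ∃ p : T.Walk u v, p.support = (List.range (n + 1)).map f ∧
      p.edges = (List.range n).map fun i => s(f i, f (i + 1)) := by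
  subst hu hv
  induction n with
  | zero => exact ⟨.nil, by simp⟩
  | succ n ih =>
    obtain ⟨p, hs, he⟩ := ih
    refine ⟨p.concat (hf n), ?_, ?_⟩
    · rw [SimpleGraph.Walk.support_concat, hs, List.range_succ (n := n + 1)]; simp
    · rw [SimpleGraph.Walk.edges_concat, he, List.range_succ (n := n)]; simp

lemma IsRay.eq_of_endpoints_eq (hT : T.IsAcyclic) {f g : ℕ → V} (hf : IsRay T f) (hg : IsRay T g)
    {n m : ℕ} (h0 : f 0 = g 0) (h1 : f n = g m) : n = m ∧ ∀ t ≤ n, f t = g t := by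
  obtain ⟨p, hp, -⟩ := exists_walk_of_adj_succ hf.2 n rfl rfl
  obtain ⟨q, hq, -⟩ := exists_walk_of_adj_succ hg.2 m h0.symm h1.symm
  have hpp : p.IsPath := by
    rw [SimpleGraph.Walk.isPath_def, hp]
    exact List.nodup_range.map hf.1
  have hqp : q.IsPath := by
    rw [SimpleGraph.Walk.isPath_def, hq]
    exact List.nodup_range.map hg.1
  have hpq : p = q := congrArg Subtype.val ((hT.subsingleton_path _ _).elim ⟨p, hpp⟩ ⟨q, hqp⟩)
  rw [hpq, hq] at hp
  have hmn : n = m := by simpa using (congrArg List.length hp).symm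
  subst hmn
  refine ⟨rfl, fun t ht => ?_⟩
  have := List.map_inj_left.1 hp t (List.mem_range.2 (by omega))
  exact this.symm

lemma isLine_of_ne_add_two (hT : T.IsAcyclic) {A : ℤ → V} (hA : ∀ i, T.Adj (A i) (A (i + 1)))
    (hne : ∀ i, A i ≠ A (i + 2)) : IsLine T A := by
  have key (i : ℤ) (n : ℕ) (hn : 0 < n) : A i ≠ A (i + n) := by
    have hadj (t : ℕ) : T.Adj (A (i + t)) (A (i + (t + 1 : ℕ))) := by
      simpa [add_assoc] using hA (i + t)
    obtain ⟨p, hs, he⟩ := exists_walk_of_adj_succ (f := fun t : ℕ => A (i + t)) hadj n rfl rfl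
    have hp : p.IsPath := by
      rw [hT.isPath_iff_isChain, he, List.isChain_map, List.isChain_iff_getElem]
      intro t ht h
      simp only [List.getElem_range, Sym2.eq_iff] at h
      rcases h with h | h
      · exact (hadj t).ne h.1
      · refine hne (i + t) (h.1.trans ?_)
        congr 1
        push_cast
        ring
    rw [SimpleGraph.Walk.isPath_def, hs] at hp
    intro h
    have := List.inj_on_of_nodup_map hp (List.mem_range.2 (Nat.succ_pos n))
      (List.mem_range.2 (Nat.lt_succ_self n)) (by simpa using h)
    omega
  refine ⟨fun i j hij => ?_, hA⟩
  by_contra hne'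
  rcases lt_or_gt_of_ne hne' with h | h
  · refine key i (j - i).toNat (by omega) ?_
    rwa [show i + ((j - i).toNat : ℤ) = j by omega]
  · refine key j (i - j).toNat (by omega) ?_
    rw [show j + ((i - j).toNat : ℤ) = i by omega, hij]

lemma IsLine.isRay_add {A : ℤ → V} (hA : IsLine T A) (i : ℤ) : IsRay T fun t : ℕ => A (i + t) := by
  refine ⟨fun s t h => by simpa using hA.1 h, fun t => ?_⟩
  simpa [add_assoc] using hA.2 (i + t)

lemma IsLine.comp_neg {A : ℤ → V} (hA : IsLine T A) : IsLine T fun i => A (-i) := by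
  refine ⟨hA.1.comp neg_injective, fun i => ?_⟩
  simpa using (hA.2 (-(i + 1))).symm

lemma IsLine.isRay {A : ℤ → V} (hA : IsLine T A) : IsRay T fun t : ℕ => A t := by
  simpa using hA.isRay_add 0

lemma IsLine.not_rayEquiv {A : ℤ → V} (hA : IsLine T A) :
    ¬ RayEquiv (fun t : ℕ => A t) (fun t : ℕ => A (-t)) := by
  refine fun h => h ((Set.finite_singleton (A 0)).subset ?_)
  rintro _ ⟨⟨s, rfl⟩, ⟨t, ht⟩⟩
  have := hA.1 ht
  have hs : s = 0 := by omega
  simp [hs]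

lemma IsLine.map {A : ℤ → V} (hA : IsLine T A) {g : Equiv.Perm V} (hg : g ∈ GraphAut T) :
    IsLine T fun i => g (A i) :=
  ⟨g.injective.comp hA.1, fun i => (hg _ _).2 (hA.2 i)⟩

lemma IsLine.eq_of_eq_of_eq (hT : T.IsAcyclic) {A B : ℤ → V} (hA : IsLine T A) (hB : IsLine T B)
    {i j i' j' : ℤ} (hij : i ≤ j) (hij' : i' ≤ j') (hi : A i = B i') (hj : A j = B j') :
    j - i = j' - i' ∧ ∀ t, i ≤ t → t ≤ j → A t = B (t + (i' - i)) := by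
  obtain ⟨h1, h2⟩ := (hA.isRay_add i).eq_of_endpoints_eq hT (hB.isRay_add i')
    (n := (j - i).toNat) (m := (j' - i').toNat) (by simpa using hi)
    (by
      rw [show i + ((j - i).toNat : ℤ) = j by omega,
        show i' + ((j' - i').toNat : ℤ) = j' by omega, hj])
  refine ⟨by omega, fun t ht ht' => ?_⟩
  have := h2 (t - i).toNat (by omega)
  rwa [show i + ((t - i).toNat : ℤ) = t by omega,
    show i' + ((t - i).toNat : ℤ) = t + (i' - i) by omega] at this

lemma RayEquiv.exists_ge {r s : ℕ → V} (h : RayEquiv r s) (n : ℕ) :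
    ∃ i j, n ≤ i ∧ r i = s j := by
  obtain ⟨_, ⟨⟨i, rfl⟩, ⟨j, hj⟩⟩, hi⟩ := h.exists_notMem_finite ((Set.finite_lt_nat n).image r)
  refine ⟨i, j, ?_, hj.symm⟩
  by_contra hlt
  exact hi ⟨i, by simpa using hlt, rfl⟩

lemma IsLine.exists_eq_add (hT : T.IsAcyclic) {A B : ℤ → V} (hA : IsLine T A) (hB : IsLine T B)
    (hpos : RayEquiv (fun t : ℕ => A t) (fun t : ℕ => B t))
    (hneg : RayEquiv (fun t : ℕ => A (-t)) (fun t : ℕ => B (-t))) :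
    ∃ c : ℤ, ∀ j, A j = B (j + c) := by
  obtain ⟨a, a', -, ha⟩ := hpos.exists_ge 0
  refine ⟨a' - a, fun t => ?_⟩
  obtain ⟨i, i', hi, hii'⟩ := hneg.exists_ge t.natAbs
  obtain ⟨j, j', hj, hjj'⟩ := hpos.exists_ge t.natAbs
  obtain ⟨h1, -⟩ := hA.eq_of_eq_of_eq hT hB (by omega) (by omega) hii' ha
  obtain ⟨-, h2⟩ := hA.eq_of_eq_of_eq hT hB (by omega) (by omega) hii' hjj'
  rw [h2 t (by omega) (by omega)]
  congr 1
  omega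

lemma TwoTransitiveOnEnds.exists_map_line (hT : T.IsAcyclic) {H : Subgroup (Equiv.Perm V)}
    (hH : H ≤ GraphAut T) (h : TwoTransitiveOnEnds T H) {A B : ℤ → V} (hA : IsLine T A)
    (hB : IsLine T B) : ∃ g ∈ H, ∃ c : ℤ, ∀ j, g (A j) = B (j + c) := by
  obtain ⟨g, hg, h1, h2⟩ := h _ _ _ _ hA.isRay hA.comp_neg.isRay hB.isRay hB.comp_neg.isRay
    hA.not_rayEquiv hB.not_rayEquiv
  exact ⟨g, hg, (hA.map (hH hg)).exists_eq_add hT hB h1 h2⟩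

lemma IsRay.exists_isLine_extend (hT : T.IsAcyclic) (hdeg : ∀ v : V, 1 < (T.neighborSet v).encard)
    {r : ℕ → V} (hr : IsRay T r) {v : V} (hv : T.Adj v (r 0)) (hne : v ≠ r 1) :
    ∃ A, IsLine T A ∧ (∀ i : ℕ, A i = r i) ∧ A (-1) = v := by
  have hex (x y : V) : ∃ z, T.Adj y z ∧ z ≠ x := Set.exists_ne_of_one_lt_encard (hdeg y) x
  choose next hadj hnext using hex
  let u : ℕ → V × V := fun n => n.rec (r 0, v) fun _ p => (p.2, next p.1 p.2)
  let A : ℤ → V := fun j => Int.casesOn j r fun n => (u n).2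
  have hpos (n : ℕ) : A n = r n := rfl
  have hneg (n : ℕ) : A (Int.negSucc n) = (u n).2 := rfl
  refine ⟨A, isLine_of_ne_add_two hT ?_ ?_, hpos, rfl⟩
  · rintro (n | _ | n)
    · exact hr.2 n
    · exact hv
    · exact (hadj (u n).1 (u n).2).symm
  · rintro (n | _ | _ | n)
    · exact fun h => by simpa using hr.1 h
    · exact hne
    · exact hnext _ _
    · exact hnext _ _

lemma IsLine.exists_axis {A : ℤ → V} (hA : IsLine T A) {g : Equiv.Perm V} (hg : g ∈ GraphAut T)
    {k : ℤ} (hk : 0 < k) {N : ℤ} (h : ∀ j, N ≤ j → g (A j) = A (j + k)) :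
    ∃ D, IsLine T D ∧ ∀ j, g (D j) = D (j + k) := by
  have hinv (f : Equiv.Perm V) (x : V) : f (f⁻¹ x) = x := f.apply_symm_apply x
  let F : ℕ → ℤ → V := fun m j => (g ^ m)⁻¹ (A (j + m * k))
  have hF (m : ℕ) : IsLine T (F m) := by
    have hAm : IsLine T fun j => A (j + m * k) := by
      refine ⟨fun i j hij => by simpa using hA.1 hij, fun i => ?_⟩
      simpa [add_right_comm] using hA.2 (i + m * k)
    exact hAm.map (inv_mem (pow_mem hg m))
  have hgF (m : ℕ) (j : ℤ) : g (F (m + 1) j) = F m (j + k) := by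
    simp only [F, pow_succ, mul_inv_rev, Equiv.Perm.mul_apply, hinv]
    congr 2
    push_cast
    ring
  let M : ℤ → ℕ := fun j => (N - j).toNat
  have hM (j : ℤ) (m : ℕ) (hm : M j ≤ m) : F m j = F (M j) j := by
    induction m, hm using Nat.le_induction with
    | base => rfl
    | succ m hm ih =>
      rw [← ih]
      have hN : N ≤ j + m * k := by
        have : (m : ℤ) ≤ m * k := le_mul_of_one_le_right (by positivity) hk
        simp only [M] at hm
        omega
      apply (g ^ (m + 1)).injective
      have h1 : (g ^ (m + 1)) (F m j) = g (A (j + m * k)) := by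
        simp [F, pow_succ']
      rw [h1, h _ hN]
      simp only [F, hinv]
      congr 1
      push_cast
      ring
  refine ⟨fun j => F (M j) j, ⟨fun i j hij => ?_, fun i => ?_⟩, fun j => ?_⟩
  · simp only [← hM i (max (M i) (M j)) (le_max_left _ _),
      ← hM j (max (M i) (M j)) (le_max_right _ _)] at hij
    exact (hF _).1 hij
  · simp only [← hM i (max (M i) (M (i + 1))) (le_max_left _ _),
      ← hM (i + 1) (max (M i) (M (i + 1))) (le_max_right _ _)]
    exact (hF _).2 i
  · have hle : M (j + k) ≤ M j := by simp only [M]; omega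
    simp only [← hM j (M j + 1) (Nat.le_succ _), ← hM (j + k) (M j) hle]
    exact hgF _ _

end Lines

/-- If a group of automorphisms of a locally finite thick tree acts
2-transitively on the set of ends, then given a ray `r` and two vertices `v₀, v₀'` adjacent to
the initial vertex of `r` and different from the next vertex of `r`, some element of the group
fixes `r` pointwise and maps `v₀` to `v₀'`. -/
theorem statement_17 {V : Type*} (T : SimpleGraph V) (hT : T.IsTree)
    (hlf : ∀ v : V, (T.neighborSet v).Finite) (hthick : ∀ v : V, 3 ≤ (T.neighborSet v).encard)
    (H : Subgroup (Equiv.Perm V)) (hHaut : H ≤ GraphAut T)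
    (h2t : TwoTransitiveOnEnds T H)
    (r : ℕ → V) (hr : IsRay T r) (v₀ v₀' : V)
    (hv₀ : T.Adj v₀ (r 0)) (hv₀' : T.Adj v₀' (r 0)) (hne : v₀ ≠ r 1) (hne' : v₀' ≠ r 1) :
    ∃ g ∈ H, (∀ i, (g : Equiv.Perm V) (r i) = r i) ∧ (g : Equiv.Perm V) v₀ = v₀' := by
  have hac := hT.isAcyclic
  have hdeg (v : V) : 1 < (T.neighborSet v).encard := lt_of_lt_of_le (by norm_num) (hthick v)
  obtain ⟨A, hA, hAr, hAv⟩ := hr.exists_isLine_extend hac hdeg hv₀ hne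
  obtain ⟨B, hB, hBr, hBv⟩ := hr.exists_isLine_extend hac hdeg hv₀' hne'
  have hAB (j : ℤ) (hj : 0 ≤ j) : A j = B j := by
    lift j to ℕ using hj
    rw [hAr, hBr]
  suffices ∃ g ∈ H, ∀ j, g (A j) = B j by
    obtain ⟨g, hg, hgAB⟩ := this
    exact ⟨g, hg, fun i => by rw [← hAr, hgAB, hBr, hAr], by rw [← hAv, hgAB, hBv]⟩
  obtain ⟨g, hg, c, hgc⟩ := h2t.exists_map_line hac hHaut hA hB
  obtain rfl | hc := eq_or_ne c 0
  · exact ⟨g, hg, by simpa using hgc⟩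
  obtain ⟨D, hD, hgD⟩ : ∃ D, IsLine T D ∧ ∀ j, g (D j) = D (j + c) := by
    rcases lt_or_gt_of_ne hc with hc | hc
    · obtain ⟨D, hD, hgD⟩ := hA.exists_axis (inv_mem (hHaut hg)) (k := -c) (by omega) (N := 0)
        fun j hj => by rw [Equiv.Perm.inv_eq_iff_eq, hgc, hAB j hj]; simp
      refine ⟨D, hD, fun j => ?_⟩
      rw [← Equiv.Perm.eq_inv_iff_eq, hgD]
      simp
    · exact hA.exists_axis (hHaut hg) hc (N := 0) fun j hj => by
        rw [hgc, hAB (j + c) (by omega)]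
  obtain ⟨f, hf, d, hfd⟩ := h2t.exists_map_line hac hHaut hD hB
  have hfB (j : ℤ) : f⁻¹ (B j) = D (j - d) := by
    rw [Equiv.Perm.inv_eq_iff_eq, hfd]
    simp
  have hgD' (j : ℤ) : g⁻¹ (D j) = D (j - c) := by
    rw [Equiv.Perm.inv_eq_iff_eq, hgD]
    simp
  refine ⟨f * g⁻¹ * f⁻¹ * g, mul_mem (mul_mem (mul_mem hf (inv_mem hg)) (inv_mem hf)) hg,
    fun j => ?_⟩
  simp only [Equiv.Perm.mul_apply, hgc, hfB, hgD', hfd]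
  congr 1
  ring
end
end

section
/- Let T be a locally finite tree, let Aut(T) carry the topology of pointwise convergence on the vertex set, and let t ∈ Aut(T) be an automorphism stabilizing the vertex set of a bi-infinite geodesic (w_i)_{i∈ℤ}, whose two ends are a (the class of the ray (w_{-i})_{i≥1}) and b (the class of the ray (w_i)_{i≥1}). Then: (i) if t fixes every vertex w_i, then Con_{Aut(T)}(t) = {id}; (ii) if t(w_i) = w_{i+k} for all i and some k > 0 (t translates the geodesic toward b), then Par_{Aut(T)}(t) equals the subgroup of all automorphisms of T fixing the end a. -/
open Filter Topology Set

noncomputable section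

/-- The contraction group associated to an element `t` of a topological group. -/
def conGroup {G : Type*} [Group G] [TopologicalSpace G] (t : G) : Set G :=
  {g | Filter.Tendsto (fun n : ℕ => t ^ n * g * (t ^ n)⁻¹) Filter.atTop (nhds 1)}

/-- The parabolic subgroup associated to an element `t` of a topological group. -/
def parGroup {G : Type*} [Group G] [TopologicalSpace G] (t : G) : Set G :=
  {g | IsCompact (closure (Set.range fun n : ℕ => t ^ n * g * (t ^ n)⁻¹))}

/-- The topology of pointwise convergence on the automorphism group of a graph whose vertex
set is a (discrete) topological space. -/
instance graphAutTop {V : Type*} [TopologicalSpace V] (T : SimpleGraph V) :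
    TopologicalSpace (GraphAut T) :=
  TopologicalSpace.induced (fun g => (((g : Equiv.Perm V) : V → V))) Pi.topologicalSpace

open SimpleGraph in
/-- A ray restricts to a path between any two of its vertices. -/
theorem IsRay.exists_path {V : Type*} {T : SimpleGraph V} {r : ℕ → V} (hr : IsRay T r)
    (a d : ℕ) : ∃ p : T.Walk (r a) (r (a + d)), p.IsPath ∧ p.length = d ∧
      ∀ v, v ∈ p.support ↔ ∃ m ≤ d, v = r (a + m) := by
  induction d with
  | zero => exact ⟨.nil, by simp, by simp, by simp⟩
  | succ d ih =>
    obtain ⟨p, hp, hl, hs⟩ := ih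
    refine ⟨p.concat (hr.2 (a + d)), hp.concat ?_ _, by simp [hl], fun v => ?_⟩
    · rw [hs]
      rintro ⟨m, hm, h⟩
      have := hr.1 h
      omega
    · simp only [Walk.support_concat, List.mem_append, hs, List.mem_singleton]
      constructor
      · rintro (⟨m, hm, rfl⟩ | rfl)
        · exact ⟨m, by omega, rfl⟩
        · exact ⟨d + 1, le_rfl, rfl⟩
      · rintro ⟨m, hm, rfl⟩
        rcases Nat.lt_or_ge d m with h | h
        · obtain rfl : m = d + 1 := by omega
          exact Or.inr rfl
        · exact Or.inl ⟨m, h, rfl⟩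

/-- In an acyclic graph every walk visits all vertices of the path with the same endpoints. -/
theorem SimpleGraph.IsAcyclic.support_subset_of_isPath {V : Type*} {T : SimpleGraph V}
    (hT : T.IsAcyclic) {u v : V} {p : T.Walk u v} (hp : p.IsPath) (q : T.Walk u v) :
    p.support ⊆ q.support := by
  classical
  have h : (⟨p, hp⟩ : T.Path u v) = ⟨q.bypass, q.bypass_isPath⟩ :=
    (hT.subsingleton_path _ _).elim _ _
  rw [show p = q.bypass from congrArg Subtype.val h]
  exact q.support_bypass_subset_support

theorem IsRay.dist_eq {V : Type*} {T : SimpleGraph V} (hT : T.IsTree) {r : ℕ → V}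
    (hr : IsRay T r) (a d : ℕ) : T.dist (r a) (r (a + d)) = d := by
  obtain ⟨p, hp, hl, -⟩ := hr.exists_path a d
  obtain ⟨q, hq, hq'⟩ := hT.connected.exists_path_of_dist (r a) (r (a + d))
  have h : (⟨p, hp⟩ : T.Path _ _) = ⟨q, hq⟩ :=
    (hT.isAcyclic.subsingleton_path _ _).elim _ _
  exact hq'.symm.trans (congrArg (fun P : T.Path _ _ => P.1.length) h.symm |>.trans hl)

theorem SimpleGraph.Walk.dist_le_of_mem_support {V : Type*} {T : SimpleGraph V} {u v x : V}
    (p : T.Walk u v) (hx : x ∈ p.support) : T.dist u x ≤ p.length ∧ T.dist x v ≤ p.length := by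
  classical
  exact ⟨(SimpleGraph.dist_le _).trans (p.length_takeUntil_le_length hx),
    (SimpleGraph.dist_le _).trans (p.length_dropUntil_le_length hx)⟩

/-- Rays of a tree that stay at bounded distance along an arithmetic progression are
equivalent. -/
theorem IsRay.rayEquiv_of_dist_le {V : Type*} {T : SimpleGraph V} (hT : T.IsTree)
    {x y : ℕ → V} (hx : IsRay T x) (hy : IsRay T y) {k : ℕ} (hk : 0 < k) {C : ℕ}
    (h : ∀ n : ℕ, T.dist (x (n * k)) (y (n * k)) ≤ C) : RayEquiv x y := by
  have key : ∀ N, x (N * k + (C + 1)) ∈ Set.range y := by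
    intro N
    have hle : 2 * C + 2 ≤ (2 * C + 2) * k := Nat.le_mul_of_pos_right _ hk
    have hend : N * k + (2 * C + 2) * k = (N + (2 * C + 2)) * k := by ring
    obtain ⟨p, hp, -, hps⟩ := hx.exists_path (N * k) ((2 * C + 2) * k)
    obtain ⟨q, -, -, hqs⟩ := hy.exists_path (N * k) ((2 * C + 2) * k)
    obtain ⟨s, hs⟩ := hT.connected.exists_walk_length_eq_dist (x (N * k)) (y (N * k))
    obtain ⟨e, he⟩ := hT.connected.exists_walk_length_eq_dist
      (y (N * k + (2 * C + 2) * k)) (x (N * k + (2 * C + 2) * k))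
    have hsC : s.length ≤ C := hs ▸ h N
    have heC : e.length ≤ C := by
      rw [he, SimpleGraph.dist_comm, hend]
      exact h _
    have hmem := hT.isAcyclic.support_subset_of_isPath hp ((s.append q).append e)
      ((hps (x (N * k + (C + 1)))).2 ⟨C + 1, by omega, rfl⟩)
    rw [SimpleGraph.Walk.mem_support_append_iff, SimpleGraph.Walk.mem_support_append_iff] at hmem
    rcases hmem with (hm | hm) | hm
    · have h1 := (s.dist_le_of_mem_support hm).1
      rw [hx.dist_eq hT] at h1
      omega
    · obtain ⟨m, -, hm⟩ := (hqs _).1 hm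
      exact ⟨_, hm.symm⟩
    · have h1 := (e.dist_le_of_mem_support hm).2
      have h2 := hx.dist_eq hT (N * k + (C + 1)) ((2 * C + 2) * k - (C + 1))
      rw [show N * k + (C + 1) + ((2 * C + 2) * k - (C + 1)) = N * k + (2 * C + 2) * k by omega]
        at h2
      omega
  refine Set.infinite_of_injective_forall_mem (f := fun N => x (N * k + (C + 1))) ?_
    fun N => ⟨⟨_, rfl⟩, key N⟩
  intro a b hab
  have := hx.1 hab
  exact Nat.eq_of_mul_eq_mul_right hk (by omega)

/-- Equivalent rays of a tree stay at bounded distance. -/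
theorem IsRay.exists_dist_le {V : Type*} {T : SimpleGraph V} (hT : T.IsTree)
    {x y : ℕ → V} (hx : IsRay T x) (hy : IsRay T y) (h : RayEquiv x y) :
    ∃ C : ℕ, ∀ n, T.dist (x n) (y n) ≤ C := by
  obtain ⟨_, ⟨i, rfl⟩, j, hij⟩ := h.nonempty
  have hdist : ∀ {r : ℕ → V}, IsRay T r → ∀ a b c : ℕ, a ≤ b + c → b ≤ a + c →
      T.dist (r a) (r b) ≤ c := by
    intro r hr a b c h1 h2
    rcases le_total a b with hab | hab
    · obtain ⟨d, rfl⟩ := Nat.exists_eq_add_of_le hab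
      rw [hr.dist_eq hT]
      omega
    · obtain ⟨d, rfl⟩ := Nat.exists_eq_add_of_le hab
      rw [SimpleGraph.dist_comm, hr.dist_eq hT]
      omega
  refine ⟨2 * (i + j), fun n => ?_⟩
  rcases Nat.lt_or_ge n i with hn | hn
  · have h1 := hdist hx n i i (by omega) (by omega)
    have h2 := hdist hy j n (i + j) (by omega) (by omega)
    have h3 := hT.connected.dist_triangle (u := x n) (v := x i) (w := y n)
    rw [hij] at h2
    omega
  · obtain ⟨d, rfl⟩ := Nat.exists_eq_add_of_le hn
    obtain ⟨_, ⟨⟨i', rfl⟩, j', hij'⟩, hout⟩ :=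
      (h.sdiff (((Set.finite_Iic (i + d)).image x).union ((Set.finite_Iic j).image y))).nonempty
    have hi' : i + d < i' := by
      by_contra hc
      exact hout (Or.inl ⟨i', not_lt.1 hc, rfl⟩)
    have hj' : j < j' := by
      by_contra hc
      exact hout (Or.inr ⟨j', not_lt.1 hc, hij'⟩)
    obtain ⟨a, rfl⟩ := Nat.exists_eq_add_of_lt hi'
    obtain ⟨b, rfl⟩ := Nat.exists_eq_add_of_lt hj'
    obtain ⟨p, hp, -, hps⟩ := hx.exists_path i (d + a + 1)
    obtain ⟨q, -, -, hqs⟩ := hy.exists_path j (b + 1)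
    have hend : y (j + (b + 1)) = x (i + (d + a + 1)) := by
      simpa only [add_assoc] using hij'
    obtain ⟨m, -, hm⟩ := (hqs _).1 <| by
      simpa using hT.isAcyclic.support_subset_of_isPath hp (q.copy hij hend)
        ((hps (x (i + d))).2 ⟨d, by omega, rfl⟩)
    have h1 := hx.dist_eq hT i d
    rw [hm, ← hij, hy.dist_eq hT] at h1
    rw [hm, h1]
    exact hdist hy _ _ _ (by omega) (by omega)

theorem SimpleGraph.Connected.finite_setOf_dist_le {V : Type*} {T : SimpleGraph V}
    (hT : T.Connected) (hlf : ∀ v : V, (T.neighborSet v).Finite) (v : V) (n : ℕ) :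
    {u | T.dist v u ≤ n}.Finite := by
  induction n generalizing v with
  | zero =>
    refine (Set.finite_singleton v).subset fun u hu => ?_
    exact (hT.dist_eq_zero_iff.1 (Nat.le_zero.1 hu)).symm
  | succ n ih =>
    refine (((hlf v).biUnion fun u _ => ih u).union (Set.finite_singleton v)).subset fun u hu => ?_
    obtain ⟨p, hp⟩ := hT.exists_walk_length_eq_dist v u
    rw [Set.mem_ofPred_eq, ← hp] at hu
    cases p with
    | nil => exact Or.inr rfl
    | cons h p =>
      refine Or.inl (Set.mem_biUnion h ?_)
      rw [SimpleGraph.Walk.length_cons] at hu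
      exact (SimpleGraph.dist_le p).trans (by omega)

theorem GraphAut.dist_apply {V : Type*} {T : SimpleGraph V} (hT : T.Connected)
    (g : GraphAut T) (u v : V) :
    T.dist ((g : Equiv.Perm V) u) ((g : Equiv.Perm V) v) = T.dist u v := by
  have key : ∀ (g : GraphAut T) (u v : V),
      T.dist ((g : Equiv.Perm V) u) ((g : Equiv.Perm V) v) ≤ T.dist u v := by
    intro g u v
    obtain ⟨p, hp⟩ := hT.exists_walk_length_eq_dist u v
    let f : T →g T := ⟨(g : Equiv.Perm V), fun {a b} h => (g.2 a b).2 h⟩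
    rw [← hp, ← p.length_map f]
    exact SimpleGraph.dist_le (p.map f)
  refine le_antisymm (key g u v) ?_
  simpa using key g⁻¹ ((g : Equiv.Perm V) u) ((g : Equiv.Perm V) v)

theorem GraphAut.continuous_apply {V : Type*} [TopologicalSpace V] (T : SimpleGraph V) (v : V) :
    Continuous fun g : GraphAut T => (g : Equiv.Perm V) v :=
  (_root_.continuous_apply v).comp continuous_induced_dom

/-- The automorphisms moving a given vertex by a bounded amount form a compact set. -/
theorem GraphAut.isCompact_setOf_dist_le {V : Type*} [TopologicalSpace V] [DiscreteTopology V]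
    {T : SimpleGraph V} (hT : T.Connected) (hlf : ∀ v : V, (T.neighborSet v).Finite)
    (o : V) (C : ℕ) : IsCompact {g : GraphAut T | T.dist ((g : Equiv.Perm V) o) o ≤ C} := by
  have hind : IsInducing fun g : GraphAut T => ((g : Equiv.Perm V) : V → V) := ⟨rfl⟩
  have hball := hT.finite_setOf_dist_le hlf
  rw [hind.isCompact_iff]
  have hK : IsCompact (Set.univ.pi fun v : V => {u | T.dist o u ≤ T.dist v o + C}) :=
    isCompact_univ_pi fun v => (hball o _).isCompact
  have himage : (fun g : GraphAut T => ((g : Equiv.Perm V) : V → V)) ''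
      {g : GraphAut T | T.dist ((g : Equiv.Perm V) o) o ≤ C} =
      {f | T.dist (f o) o ≤ C} ∩ ((⋂ u, ⋂ v, {f : V → V | T.Adj (f u) (f v) ↔ T.Adj u v}) ∩
        ((⋂ u, ⋂ v, {f : V → V | f u = f v → u = v}) ∩
          ⋂ v, ⋃ u ∈ {u | T.dist o u ≤ T.dist v o + C}, {f : V → V | f u = v})) := by
    ext f
    simp only [Set.mem_image, Set.mem_inter_iff, Set.mem_iInter, Set.mem_iUnion, Set.mem_ofPred_eq,
      exists_prop]
    constructor
    · rintro ⟨g, hg, rfl⟩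
      refine ⟨hg, g.2, fun u v h => (g : Equiv.Perm V).injective h, fun v =>
        ⟨(g : Equiv.Perm V).symm v, ?_, by simp⟩⟩
      have h1 := GraphAut.dist_apply hT g o ((g : Equiv.Perm V).symm v)
      rw [Equiv.apply_symm_apply] at h1
      have h2 := hT.dist_triangle (u := (g : Equiv.Perm V) o) (v := o) (w := v)
      rw [SimpleGraph.dist_comm (u := v)]
      omega
    · rintro ⟨hC, hadj, hinj, hsurj⟩
      exact ⟨⟨Equiv.ofBijective f ⟨fun u v h => hinj u v h,
        fun v => (hsurj v).imp fun u hu => hu.2⟩, hadj⟩, hC, rfl⟩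
  have hclosed : ∀ (u v : V) (P : V → V → Prop), IsClosed {f : V → V | P (f u) (f v)} := by
    intro u v P
    exact (isClosed_discrete {a : V × V | P a.1 a.2}).preimage (f := fun f : V → V => (f u, f v))
      ((_root_.continuous_apply u).prodMk (_root_.continuous_apply v))
  refine hK.of_isClosed_subset ?_ ?_
  · rw [himage]
    refine (hclosed o o fun a _ => T.dist a o ≤ C).inter
      ((isClosed_iInter fun u => isClosed_iInter fun v =>
        hclosed u v fun a b => T.Adj a b ↔ T.Adj u v).inter
      ((isClosed_iInter fun u => isClosed_iInter fun v =>
        hclosed u v fun a b => a = b → u = v).inter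
        (isClosed_iInter fun v => (hball o _).isClosed_biUnion fun u _ =>
          hclosed u u fun a _ => a = v)))
  · rintro _ ⟨g, hg, rfl⟩ v -
    have h1 := GraphAut.dist_apply hT g o v
    have h2 := hT.dist_triangle (u := o) (v := (g : Equiv.Perm V) o) (w := (g : Equiv.Perm V) v)
    rw [SimpleGraph.dist_comm (u := o) (v := (g : Equiv.Perm V) o), h1,
      SimpleGraph.dist_comm (u := o) (v := v)] at h2
    have hg : T.dist ((g : Equiv.Perm V) o) o ≤ C := hg
    simp only [Set.mem_ofPred_eq]
    omega

theorem GraphAut.isCompact_closure_iff {V : Type*} [TopologicalSpace V] [DiscreteTopology V]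
    {T : SimpleGraph V} (hT : T.Connected) (hlf : ∀ v : V, (T.neighborSet v).Finite)
    (o : V) (S : Set (GraphAut T)) :
    IsCompact (closure S) ↔ ∃ C : ℕ, ∀ g ∈ S, T.dist ((g : Equiv.Perm V) o) o ≤ C := by
  constructor
  · intro h
    have hfin := ((h.image (GraphAut.continuous_apply T o)).finite_of_discrete).image
      fun v => T.dist v o
    obtain ⟨C, hC⟩ := hfin.bddAbove
    exact ⟨C, fun g hg => hC ⟨_, ⟨g, subset_closure hg, rfl⟩, rfl⟩⟩
  · rintro ⟨C, hC⟩
    refine (GraphAut.isCompact_setOf_dist_le hT hlf o C).of_isClosed_subset isClosed_closure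
      (closure_minimal hC ?_)
    exact (isClosed_discrete {a : V | T.dist a o ≤ C}).preimage (GraphAut.continuous_apply T o)

/-- The contraction group of a graph automorphism fixing a vertex is trivial. -/
theorem GraphAut.conGroup_eq_of_apply_eq {V : Type*} [TopologicalSpace V] [DiscreteTopology V]
    {T : SimpleGraph V} (hT : T.Connected) (hlf : ∀ v : V, (T.neighborSet v).Finite)
    {o : V} {t : GraphAut T} (ht : (t : Equiv.Perm V) o = o) : conGroup t = {1} := by
  refine Set.Subset.antisymm (fun g hg => ?_) ?_
  · rw [Set.mem_singleton_iff]
    refine Subtype.ext (Equiv.ext fun v => ?_)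
    have ho : ∀ n : ℕ, ((t ^ n : GraphAut T) : Equiv.Perm V) o = o := by
      intro n
      induction n with
      | zero => simp
      | succ n ih => rw [pow_succ, Subgroup.coe_mul, Equiv.Perm.mul_apply, ht, ih]
    obtain ⟨a, b, hlt, hab⟩ : ∃ a b : ℕ, a < b ∧
        ((t ^ a : GraphAut T) : Equiv.Perm V) v = ((t ^ b : GraphAut T) : Equiv.Perm V) v := by
      obtain ⟨a, -, b, -, hlt, hab⟩ := Set.infinite_univ.exists_lt_map_eq_of_mapsTo
        (f := fun n : ℕ => ((t ^ n : GraphAut T) : Equiv.Perm V) v)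
        (t := {u | T.dist o u ≤ T.dist o v}) (fun n _ => by
          have h := GraphAut.dist_apply hT (t ^ n) o v
          rw [ho] at h
          exact h.le) (hT.finite_setOf_dist_le hlf o _)
      exact ⟨a, b, hlt, hab⟩
    obtain ⟨d, rfl⟩ := Nat.exists_eq_add_of_lt hlt
    have hd : ((t ^ (d + 1) : GraphAut T) : Equiv.Perm V) v = v := by
      rw [add_assoc, pow_add, Subgroup.coe_mul, Equiv.Perm.mul_apply] at hab
      exact ((Equiv.injective _) hab).symm
    have hdn : ∀ n : ℕ, ((t ^ ((d + 1) * n) : GraphAut T) : Equiv.Perm V) v = v := by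
      intro n
      induction n with
      | zero => simp
      | succ n ih => rw [mul_add, mul_one, pow_add, Subgroup.coe_mul, Equiv.Perm.mul_apply, hd, ih]
    have hev := ((GraphAut.continuous_apply T v).tendsto 1).comp hg
    rw [nhds_discrete, tendsto_pure, eventually_atTop] at hev
    obtain ⟨N, hN⟩ := hev
    have h := hN ((d + 1) * N) (Nat.le_mul_of_pos_left N d.succ_pos)
    have hinv : ((t ^ ((d + 1) * N) : GraphAut T) : Equiv.Perm V)⁻¹ v = v :=
      Equiv.Perm.inv_eq_iff_eq.2 (hdn N).symm
    simp only [Function.comp_apply, Subgroup.coe_mul, Subgroup.coe_inv, Equiv.Perm.mul_apply,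
      hinv, Subgroup.coe_one, Equiv.Perm.one_apply] at h ⊢
    exact (Equiv.injective _) (h.trans (hdn N).symm)
  · rintro _ rfl
    simpa [conGroup] using tendsto_const_nhds

/-- Membership in the parabolic group of an automorphism amounts to bounded displacement along a
backward orbit. -/
theorem GraphAut.mem_parGroup_iff {V : Type*} [TopologicalSpace V] [DiscreteTopology V]
    {T : SimpleGraph V} (hT : T.Connected) (hlf : ∀ v : V, (T.neighborSet v).Finite)
    (o : V) (t g : GraphAut T) : g ∈ parGroup t ↔ ∃ C : ℕ, ∀ n : ℕ,
      T.dist ((g : Equiv.Perm V) (((t ^ n : GraphAut T) : Equiv.Perm V)⁻¹ o))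
        (((t ^ n : GraphAut T) : Equiv.Perm V)⁻¹ o) ≤ C := by
  have h : ∀ n : ℕ, T.dist (((t ^ n * g * (t ^ n)⁻¹ : GraphAut T) : Equiv.Perm V) o) o =
      T.dist ((g : Equiv.Perm V) (((t ^ n : GraphAut T) : Equiv.Perm V)⁻¹ o))
        (((t ^ n : GraphAut T) : Equiv.Perm V)⁻¹ o) := by
    intro n
    rw [← GraphAut.dist_apply hT (t ^ n) ((g : Equiv.Perm V) _)]
    exact congrArg (T.dist _) (Equiv.apply_symm_apply _ o).symm
  simp only [parGroup, Set.mem_ofPred_eq, GraphAut.isCompact_closure_iff hT hlf o,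
    Set.forall_mem_range, h]

/-- Let `T` be a locally finite tree, `Aut T` carrying the topology of
pointwise convergence, and let `t` be an automorphism stabilizing a bi-infinite geodesic `w`.
(i) If `t` fixes the geodesic pointwise then its contraction group is trivial.
(ii) If `t` translates the geodesic towards its end `b`, then the parabolic subgroup of `t`
is the fixator of the opposite end `a`. -/
theorem statement_19 {V : Type*} [TopologicalSpace V] [DiscreteTopology V]
    (T : SimpleGraph V) (hT : T.IsTree) (hlf : ∀ v : V, (T.neighborSet v).Finite)
    (t : GraphAut T) (w : ℤ → V) (hinj : Function.Injective w)
    (hadj : ∀ i, T.Adj (w i) (w (i + 1)))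
    (hstab : ∀ i, ∃ j, (t : Equiv.Perm V) (w i) = w j) :
    ((∀ i, (t : Equiv.Perm V) (w i) = w i) → conGroup t = {1}) ∧
    (∀ k : ℤ, 0 < k → (∀ i, (t : Equiv.Perm V) (w i) = w (i + k)) →
      parGroup t = {g : GraphAut T |
        (Set.range (fun i : ℕ => (g : Equiv.Perm V) (w (-(i : ℤ)))) ∩
          Set.range (fun i : ℕ => w (-(i : ℤ)))).Infinite}) := by
  refine ⟨fun h => GraphAut.conGroup_eq_of_apply_eq hT.connected hlf (h 0), fun k hk htr => ?_⟩
  lift k to ℕ using hk.le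
  have hk : 0 < k := by exact_mod_cast hk
  have hpow : ∀ (n : ℕ) (i : ℤ),
      ((t ^ n : GraphAut T) : Equiv.Perm V) (w i) = w (i + (n * k : ℕ)) := by
    intro n
    induction n with
    | zero => simp
    | succ n ih =>
      intro i
      rw [pow_succ, Subgroup.coe_mul, Equiv.Perm.mul_apply, htr, ih]
      congr 1
      push_cast
      ring
  have hinv : ∀ n : ℕ,
      ((t ^ n : GraphAut T) : Equiv.Perm V)⁻¹ (w 0) = w (-((n * k : ℕ) : ℤ)) := by
    intro n
    rw [Equiv.Perm.inv_eq_iff_eq, hpow]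
    simp
  have hy : IsRay T fun i : ℕ => w (-(i : ℤ)) := by
    refine ⟨fun a b h => by simpa using hinj h, fun i => ?_⟩
    have h := (hadj (-((i + 1 : ℕ) : ℤ))).symm
    rwa [show -((i + 1 : ℕ) : ℤ) + 1 = -(i : ℤ) by push_cast; ring] at h
  ext g
  have hx : IsRay T fun i : ℕ => (g : Equiv.Perm V) (w (-(i : ℤ))) :=
    ⟨(g : Equiv.Perm V).injective.comp hy.1, fun i => (g.2 _ _).2 (hy.2 i)⟩
  rw [GraphAut.mem_parGroup_iff hT.connected hlf (w 0)]
  simp only [hinv]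
  constructor
  · rintro ⟨C, hC⟩
    exact hx.rayEquiv_of_dist_le hT hy hk hC
  · intro h
    obtain ⟨C, hC⟩ := hx.exists_dist_le hT hy h
    exact ⟨C, fun n => hC (n * k)⟩
end
end
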